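/- Let A_0,A_1,A_2 be C^∞ m×m matrix functions supported in B_R, let c₊(x,t) on closure(B_{2R})×closure(D⁺) solve ζ(t)·∂c₊/∂x = (A₁ζ₁(t)+A₂ζ₂(t)+A₀)c₊, be smooth with det c₊≠0 everywhere, and for each x be analytic in t on D⁺ and at t=∞ with det c₊(x,∞)≠0. Let f be C^∞ and supported in B_R, and set u₊(x,t) = c₊(x,t)·(Π(t)(c₊(·,t)^{-1}f))(x). Then for every ρ>1 and every x∈B_{2R}, (1/(2πi))∮_{|t|=ρ} u₊(x,t) dt = c₊(x,∞)·(S(c₊(·,∞)^{-1}f))(x), where S is the Cauchy transform; in particular the contour integral is independent of ρ>1. -/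

import Mathlib

noncomputable section

open MeasureTheory Filter Topology Complex Matrix

abbrev R2 : Type := EuclideanSpace ℝ (Fin 2)
abbrev Mat (m : ℕ) : Type := Matrix (Fin m) (Fin m) ℂ
abbrev Vec (m : ℕ) : Type := Fin m → ℂ

/-- the point (a,b) ∈ ℝ² -/
def mk2 (a b : ℝ) : R2 := (WithLp.equiv 2 (Fin 2 → ℝ)).symm ![a, b]
def e1 : R2 := mk2 1 0
def e2 : R2 := mk2 0 1

/-- partial derivative of a scalar function in direction v -/
def pdv (v : R2) (f : R2 → ℂ) (x : R2) : ℂ := fderiv ℝ f x v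

def zeta1 (t : ℂ) : ℂ := (t + t⁻¹) / 2
def zeta2 (t : ℂ) : ℂ := (t - t⁻¹) / (2 * Complex.I)

/-- z = x₁ + i x₂ -/
def zOf (x : R2) : ℂ := (x 0 : ℂ) + Complex.I * (x 1 : ℂ)

/-- the kernel denominator t(z−z′)+t⁻¹(z̄−z̄′) -/
def ker (t : ℂ) (x y : R2) : ℂ :=
  t * (zOf x - zOf y) + t⁻¹ * (starRingEnd ℂ) (zOf x - zOf y)

/-- ζ·∂c/∂x for a matrix-valued function, entrywise -/
def zDirM {m : ℕ} (z1 z2 : ℂ) (c : R2 → Mat m) (x : R2) : Mat m :=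
  Matrix.of fun i j => z1 * pdv e1 (fun y => c y i j) x + z2 * pdv e2 (fun y => c y i j) x

def zDirV {m : ℕ} (z1 z2 : ℂ) (u : R2 → Vec m) (x : R2) : Vec m :=
  fun i => z1 * pdv e1 (fun y => u y i) x + z2 * pdv e2 (fun y => u y i) x

/-- ∂/∂z̄ of a matrix-valued function -/
def dzbarM {m : ℕ} (c : R2 → Mat m) (x : R2) : Mat m :=
  Matrix.of fun i j =>
    (pdv e1 (fun y => c y i j) x + Complex.I * pdv e2 (fun y => c y i j) x) / 2

def dzbarV {m : ℕ} (u : R2 → Vec m) (x : R2) : Vec m :=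
  fun i => (pdv e1 (fun y => u y i) x + Complex.I * pdv e2 (fun y => u y i) x) / 2

def dzM {m : ℕ} (c : R2 → Mat m) (x : R2) : Mat m :=
  Matrix.of fun i j =>
    (pdv e1 (fun y => c y i j) x - Complex.I * pdv e2 (fun y => c y i j) x) / 2

/-- the operator Π(t), matrix-valued version -/
def PiTM {m : ℕ} (t : ℂ) (f : R2 → Mat m) (x : R2) : Mat m :=
  Matrix.of fun i j => (Real.pi : ℂ)⁻¹ * ∫ y : R2, f y i j / ker t x y

def PiTV {m : ℕ} (t : ℂ) (f : R2 → Vec m) (x : R2) : Vec m :=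
  fun i => (Real.pi : ℂ)⁻¹ * ∫ y : R2, f y i / ker t x y

/-- the Cauchy transform S -/
def CauchyM {m : ℕ} (f : R2 → Mat m) (x : R2) : Mat m :=
  Matrix.of fun i j => (Real.pi : ℂ)⁻¹ * ∫ y : R2, f y i j / (zOf x - zOf y)

def CauchyV {m : ℕ} (f : R2 → Vec m) (x : R2) : Vec m :=
  fun i => (Real.pi : ℂ)⁻¹ * ∫ y : R2, f y i / (zOf x - zOf y)

/-- the contour integral ∮_{|t|=ρ} F(t) dt -/
def circIntM {m : ℕ} (F : ℂ → Mat m) (ρ : ℝ) : Mat m :=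
  Matrix.of fun i j => ∫ φ in (0:ℝ)..(2*Real.pi),
    F ((ρ:ℂ) * Complex.exp (Complex.I * φ)) i j * (Complex.I * ρ * Complex.exp (Complex.I * φ))

def circIntV {m : ℕ} (F : ℂ → Vec m) (ρ : ℝ) : Vec m :=
  fun i => ∫ φ in (0:ℝ)..(2*Real.pi),
    F ((ρ:ℂ) * Complex.exp (Complex.I * φ)) i * (Complex.I * ρ * Complex.exp (Complex.I * φ))

def MatSmooth {m : ℕ} (c : R2 → Mat m) : Prop := ∀ i j, ContDiff ℝ (⊤ : ℕ∞) (fun x => c x i j)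

def SuppIn {m : ℕ} (A : R2 → Mat m) (R : ℝ) : Prop := ∀ x : R2, R ≤ ‖x‖ → A x = 0

/-- A(x,ζ) = ζ₁A₁(x)+ζ₂A₂(x)+A₀(x) -/
def Acomb {m : ℕ} (A0 A1 A2 : R2 → Mat m) (z1 z2 : ℂ) (x : R2) : Mat m :=
  z1 • A1 x + z2 • A2 x + A0 x

/-- c solves θ·∂c/∂x = M(x)c along every line in direction θ -/
def Transport {m : ℕ} (M : R2 → Mat m) (θ : R2) (c : R2 → Mat m) : Prop :=
  ∀ x : R2, ∀ i j, HasDerivAt (fun s : ℝ => c (x + s • θ) i j) ((M x * c x) i j) 0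

open Classical in
/-- extension at infinity: `extInf F L` equals `F (1/s)` for `s ≠ 0` and `L` at `s = 0`;
analyticity of this at `0` encodes analyticity of `F` at `t = ∞` with value `L`. -/
def extInf {m : ℕ} (F : ℂ → Mat m) (L : Mat m) (s : ℂ) : Mat m := if s = 0 then L else F s⁻¹
lemma norm_zOf_sub (x y : R2) : ‖zOf x - zOf y‖ = ‖x - y‖ := by
  have h : zOf x - zOf y = ((x - y) 0 : ℂ) + ((x - y) 1 : ℂ) * Complex.I := by
    simp only [zOf, PiLp.sub_apply]
    push_cast
    ring
  rw [h, Complex.norm_add_mul_I, EuclideanSpace.norm_eq, Fin.sum_univ_two]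
  simp

/-- The point `ρ e^{iφ}`, parametrized as in `circIntV`. -/
def circPt (ρ φ : ℝ) : ℂ := (ρ : ℂ) * Complex.exp (Complex.I * φ)

lemma norm_circPt {ρ : ℝ} (hρ : 0 < ρ) (φ : ℝ) : ‖circPt ρ φ‖ = ρ := by
  rw [circPt, norm_mul, mul_comm Complex.I, Complex.norm_exp_ofReal_mul_I]
  simp [abs_of_pos hρ]

lemma continuous_circPt (ρ : ℝ) : Continuous (circPt ρ) := by
  unfold circPt
  fun_prop

/-- Mean value property, with the boundary circle traversed through `(ρ e^{iφ})⁻¹`. -/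
lemma integral_comp_inv_circPt {k : ℂ → ℂ} (hk : DifferentiableOn ℂ k (Metric.ball 0 1))
    {ρ : ℝ} (hρ : 1 < ρ) :
    ∫ φ in (0 : ℝ)..(2 * Real.pi), k (circPt ρ φ)⁻¹ = 2 * Real.pi * k 0 := by
  have hρ0 : 0 < ρ := by linarith
  have hinv : ρ⁻¹ < 1 := inv_lt_one_of_one_lt₀ hρ
  have hd : DiffContOnCl ℂ k (Metric.ball 0 |ρ⁻¹|) := by
    apply DifferentiableOn.diffContOnCl
    rw [abs_of_pos (inv_pos.2 hρ0), closure_ball _ (inv_pos.2 hρ0).ne']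
    exact hk.mono (Metric.closedBall_subset_ball hinv)
  have h := hd.circleAverage
  rw [Real.circleAverage_def] at h
  have hsub : ∫ φ in (0 : ℝ)..(2 * Real.pi), k (circPt ρ φ)⁻¹ =
      ∫ φ in (0 : ℝ)..(2 * Real.pi), k (circleMap 0 ρ⁻¹ φ) := by
    have := intervalIntegral.integral_comp_sub_left (a := 0) (b := 2 * Real.pi)
      (fun φ => k (circleMap 0 ρ⁻¹ φ)) (2 * Real.pi)
    simp only [sub_self, sub_zero] at this
    rw [← this]
    congr 1
    ext φ
    congr 1
    rw [circPt, mul_inv, ← Complex.exp_neg, circleMap, zero_add]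
    push_cast
    congr 1
    rw [sub_mul, Complex.exp_sub, Complex.exp_two_pi_mul_I, one_div, ← Complex.exp_neg,
      mul_comm Complex.I]
  rw [hsub, ← h]
  have hpi : (Real.pi : ℂ) ≠ 0 := by exact_mod_cast Real.pi_ne_zero
  rw [Complex.real_smul]
  push_cast
  field_simp

lemma ker_eq (t : ℂ) (ht : t ≠ 0) (x y : R2) :
    ker t x y = t * ((zOf x - zOf y) + t⁻¹ ^ 2 * (starRingEnd ℂ) (zOf x - zOf y)) := by
  unfold _root_.ker
  field_simp

lemma le_norm_ker {t : ℂ} {ρ : ℝ} (ht : ‖t‖ = ρ) (x y : R2) :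
    (ρ - ρ⁻¹) * ‖x - y‖ ≤ ‖ker t x y‖ := by
  have h := norm_sub_le_norm_add (t * (zOf x - zOf y))
    (t⁻¹ * (starRingEnd ℂ) (zOf x - zOf y))
  rw [norm_mul, norm_mul, norm_inv, RCLike.norm_conj, norm_zOf_sub, ht] at h
  calc _ = ρ * ‖x - y‖ - ρ⁻¹ * ‖x - y‖ := by ring
    _ ≤ _ := h

lemma add_sq_mul_conj_ne_zero {a s : ℂ} (ha : a ≠ 0) (hs : ‖s‖ < 1) :
    a + s ^ 2 * (starRingEnd ℂ) a ≠ 0 := by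
  intro h
  have h1 : a = -(s ^ 2 * (starRingEnd ℂ) a) := eq_neg_of_add_eq_zero_left h
  have h2 : ‖a‖ = ‖s‖ ^ 2 * ‖a‖ := by
    conv_lhs => rw [h1]
    rw [norm_neg, norm_mul, norm_pow, RCLike.norm_conj]
  have h3 : 0 < ‖a‖ := norm_pos_iff.2 ha
  have h4 : ‖s‖ ^ 2 < 1 := pow_lt_one₀ (norm_nonneg s) hs two_ne_zero
  nlinarith

lemma integrableOn_norm_inv_ball (r : ℝ) :
    IntegrableOn (fun x : R2 => ‖x‖⁻¹) (Metric.ball 0 r) := by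
  rw [integrableOn_fun_norm_addHaar volume (f := fun r : ℝ => r⁻¹)]
  have h : IntegrableOn (fun _ : ℝ => (1 : ℝ)) (Set.Ioo 0 r) := by
    simp
  refine h.congr_fun (fun y hy => ?_) measurableSet_Ioo
  have : y ≠ 0 := hy.1.ne'
  simp [this]

lemma continuous_zOf : Continuous zOf := by
  unfold zOf
  fun_prop

lemma integrable_div_ker {ρ R : ℝ} (hρ : 1 < ρ) (x : R2) {q : ℝ → R2 → ℂ}
    (hq : Continuous (Function.uncurry q)) (hsupp : ∀ φ y, R ≤ ‖y‖ → q φ y = 0) :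
    Integrable (Function.uncurry fun φ y => q φ y / ker (circPt ρ φ) x y)
      ((volume.restrict (Set.uIoc 0 (2 * Real.pi))).prod volume) := by
  have hρ0 : 0 < ρ := by linarith
  have hinv : ρ⁻¹ < 1 := inv_lt_one_of_one_lt₀ hρ
  have hgap : 0 < ρ - ρ⁻¹ := by linarith
  obtain ⟨C, hC⟩ := ((isCompact_Icc (a := (0 : ℝ)) (b := 2 * Real.pi)).prod
    (isCompact_closedBall (0 : R2) R)).exists_bound_of_continuousOn hq.continuousOn
  set r : ℝ := ‖x‖ + R with hr
  set b : R2 → ℝ := fun y => (Metric.ball (0 : R2) r).indicator (fun x : R2 => ‖x‖⁻¹) (x - y)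
  have hb : Integrable b := by
    have h := (integrable_indicator_iff measurableSet_ball).2 (integrableOn_norm_inv_ball r)
    exact h.comp_sub_left x
  have : IsFiniteMeasure (volume.restrict (Set.uIoc 0 (2 * Real.pi))) := by
    rw [Set.uIoc_of_le Real.two_pi_pos.le]
    infer_instance
  have hB : Integrable (fun p : ℝ × R2 => |C| / (ρ - ρ⁻¹) * b p.2)
      ((volume.restrict (Set.uIoc 0 (2 * Real.pi))).prod volume) :=
    (hb.comp_snd (volume.restrict (Set.uIoc 0 (2 * Real.pi)))).const_mul _
  refine hB.mono' ?_ ?_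
  · have hmeas : Measurable (fun p : ℝ × R2 => ker (circPt ρ p.1) x p.2) := by
      have h1 : Measurable (fun p : ℝ × R2 => circPt ρ p.1) :=
        (continuous_circPt ρ).measurable.comp measurable_fst
      have h2 : Continuous (fun p : ℝ × R2 => zOf x - zOf p.2) :=
        continuous_const.sub (continuous_zOf.comp continuous_snd)
      exact (h1.mul h2.measurable).add
        (h1.inv.mul (Complex.continuous_conj.comp h2).measurable)
    exact (hq.measurable.div hmeas).aestronglyMeasurable
  · have hae : ∀ᵐ p : ℝ × R2 ∂((volume.restrict (Set.uIoc 0 (2 * Real.pi))).prod volume),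
        p.1 ∈ Set.uIoc 0 (2 * Real.pi) :=
      Measure.quasiMeasurePreserving_fst.ae
        (ae_restrict_mem (μ := volume) measurableSet_uIoc)
    filter_upwards [hae] with p hp
    obtain ⟨φ, y⟩ := p
    rw [Set.uIoc_of_le Real.two_pi_pos.le] at hp
    have hb0 : 0 ≤ b y := Set.indicator_nonneg (fun _ _ => by positivity) _
    simp only [Function.uncurry_apply_pair]
    rcases le_or_gt R ‖y‖ with hy | hy
    · rw [hsupp φ y hy, zero_div, norm_zero]
      positivity
    · have hqb : ‖q φ y‖ ≤ |C| := by
        refine (hC (φ, y) ⟨⟨hp.1.le, hp.2⟩, ?_⟩).trans (le_abs_self C)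
        simpa using hy.le
      have hmem : x - y ∈ Metric.ball (0 : R2) r := by
        rw [mem_ball_zero_iff]
        exact (norm_sub_le x y).trans_lt (by linarith)
      have hby : b y = ‖x - y‖⁻¹ := Set.indicator_of_mem hmem _
      rw [hby, norm_div]
      rcases eq_or_lt_of_le (norm_nonneg (x - y)) with h0 | h0
      · have : x = y := sub_eq_zero.1 (norm_eq_zero.1 h0.symm)
        subst this
        simp [_root_.ker]
      · calc ‖q φ y‖ / ‖ker (circPt ρ φ) x y‖ ≤ |C| / ((ρ - ρ⁻¹) * ‖x - y‖) := by
              gcongr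
              exact le_norm_ker (norm_circPt hρ0 φ) x y
          _ = _ := by field_simp

lemma DifferentiableAt.matrix_det {n : ℕ} {M : ℂ → Mat n} {s : ℂ}
    (h : ∀ i j, DifferentiableAt ℂ (fun z => M z i j) s) :
    DifferentiableAt ℂ (fun z => (M z).det) s := by
  simp only [Matrix.det_apply']
  fun_prop

lemma DifferentiableAt.matrix_inv_apply {n : ℕ} {M : ℂ → Mat n} {s : ℂ}
    (h : ∀ i j, DifferentiableAt ℂ (fun z => M z i j) s) (hdet : (M s).det ≠ 0) (i j : Fin n) :
    DifferentiableAt ℂ (fun z => (M z)⁻¹ i j) s := by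
  simp only [Matrix.inv_def, Matrix.smul_apply, smul_eq_mul, Ring.inverse_eq_inv']
  refine ((DifferentiableAt.matrix_det h).inv hdet).mul ?_
  simp only [Matrix.adjugate_apply]
  refine DifferentiableAt.matrix_det fun a b => ?_
  by_cases hab : a = j
  · subst hab
    simp
  · simpa [Matrix.updateRow_ne hab] using h a b

lemma extInf_zero {m : ℕ} (F : ℂ → Mat m) (L : Mat m) : extInf F L 0 = L := if_pos rfl

lemma extInf_of_ne {m : ℕ} (F : ℂ → Mat m) (L : Mat m) {s : ℂ} (hs : s ≠ 0) :
    extInf F L s = F s⁻¹ := if_neg hs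

lemma differentiableAt_extInf {m : ℕ} {F : ℂ → Mat m} {L : Mat m}
    (h : ∀ i j, DifferentiableOn ℂ (fun t => F t i j) {t : ℂ | 1 < ‖t‖} ∧
      AnalyticAt ℂ (fun s => extInf F L s i j) 0)
    {s : ℂ} (hs : ‖s‖ < 1) (i j : Fin m) :
    DifferentiableAt ℂ (fun z => extInf F L z i j) s := by
  rcases eq_or_ne s 0 with rfl | h0
  · exact (h i j).2.differentiableAt
  · have hopen : IsOpen {t : ℂ | 1 < ‖t‖} := isOpen_lt continuous_const continuous_norm
    have hmem : s⁻¹ ∈ {t : ℂ | 1 < ‖t‖} := by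
      rw [Set.mem_ofPred_eq, norm_inv]
      exact (one_lt_inv₀ (norm_pos_iff.2 h0)).2 hs
    have hd : DifferentiableAt ℂ (fun z : ℂ => F z⁻¹ i j) s :=
      ((h i j).1.differentiableAt (hopen.mem_nhds hmem)).comp s (differentiableAt_inv h0)
    refine hd.congr_of_eventuallyEq ?_
    filter_upwards [isOpen_ne.mem_nhds h0] with z hz
    rw [extInf_of_ne F L hz]

lemma det_extInf_ne_zero {m : ℕ} {F : ℂ → Mat m} {L : Mat m} (hL : L.det ≠ 0)
    (hF : ∀ t : ℂ, 1 ≤ ‖t‖ → (F t).det ≠ 0) {s : ℂ} (hs : ‖s‖ < 1) :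
    (extInf F L s).det ≠ 0 := by
  rcases eq_or_ne s 0 with rfl | h0
  · rwa [extInf_zero]
  · rw [extInf_of_ne F L h0]
    apply hF
    rw [norm_inv]
    exact ((one_lt_inv₀ (norm_pos_iff.2 h0)).2 hs).le

/-- Residue at infinity of `F / ker`, where `F (1 / s) = H s` with `H` holomorphic on the disc. -/
lemma integral_div_ker {ρ : ℝ} (hρ : 1 < ρ) (x y : R2) {F H : ℂ → ℂ}
    (hH : DifferentiableOn ℂ H (Metric.ball 0 1)) (hFH : ∀ t : ℂ, 1 < ‖t‖ → F t = H t⁻¹) :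
    ∫ φ in (0 : ℝ)..(2 * Real.pi),
      F (circPt ρ φ) * (Complex.I * circPt ρ φ) / ker (circPt ρ φ) x y =
      2 * Real.pi * Complex.I * (H 0 / (zOf x - zOf y)) := by
  have hρ0 : 0 < ρ := by linarith
  rcases eq_or_ne (zOf x - zOf y) 0 with h0 | h0
  · simp [_root_.ker, h0]
  · have hk : DifferentiableOn ℂ
        (fun s => H s / ((zOf x - zOf y) + s ^ 2 * (starRingEnd ℂ) (zOf x - zOf y)))
        (Metric.ball 0 1) := by
      refine hH.div (by fun_prop) fun s hs => add_sq_mul_conj_ne_zero h0 ?_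
      simpa using hs
    have h := integral_comp_inv_circPt hk hρ
    have heq : ∀ φ : ℝ, F (circPt ρ φ) * (Complex.I * circPt ρ φ) / ker (circPt ρ φ) x y =
        Complex.I * (H (circPt ρ φ)⁻¹ / ((zOf x - zOf y) +
          (circPt ρ φ)⁻¹ ^ 2 * (starRingEnd ℂ) (zOf x - zOf y))) := by
      intro φ
      have hn := norm_circPt hρ0 φ
      have ht : circPt ρ φ ≠ 0 := norm_pos_iff.1 (by rw [hn]; exact hρ0)
      rw [ker_eq _ ht, hFH _ (by rw [hn]; exact hρ), ← mul_assoc, mul_comm (circPt ρ φ) (_ + _),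
        mul_div_mul_right _ _ ht, mul_comm (H _), mul_div_assoc]
    simp_rw [heq]
    rw [intervalIntegral.integral_const_mul, h]
    simp
    ring

/-- (3.20): the contour integral of u₊ recovers c₊(x,∞)·S(c₊(·,∞)⁻¹f). -/
theorem contour_integral_uplus (m : ℕ) (hm : 1 ≤ m) (R : ℝ) (hR : 0 < R)
    (A : Fin 3 → R2 → Mat m)
    (hAsm : ∀ j, MatSmooth (A j)) (hAsupp : ∀ j, SuppIn (A j) R)
    (cp : R2 → ℂ → Mat m) (cpinf : R2 → Mat m)
    (heq : ∀ x : R2, ‖x‖ ≤ 2*R → ∀ t : ℂ, 1 ≤ ‖t‖ →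
      zDirM (zeta1 t) (zeta2 t) (fun y => cp y t) x =
        Acomb (A 0) (A 1) (A 2) (zeta1 t) (zeta2 t) x * cp x t)
    (hsm : ∀ i j, ContDiffOn ℝ (⊤ : ℕ∞) (fun p : R2 × ℂ => cp p.1 p.2 i j)
      {p : R2 × ℂ | ‖p.1‖ ≤ 2*R ∧ 1 ≤ ‖p.2‖})
    (hdet : ∀ (x : R2) (t : ℂ), ‖x‖ ≤ 2*R → 1 ≤ ‖t‖ → (cp x t).det ≠ 0)
    (han : ∀ x : R2, ‖x‖ ≤ 2*R → ∀ i j,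
      DifferentiableOn ℂ (fun t => cp x t i j) {t : ℂ | 1 < ‖t‖} ∧
      AnalyticAt ℂ (fun s => extInf (cp x) (cpinf x) s i j) 0)
    (hdinf : ∀ x : R2, ‖x‖ ≤ 2*R → (cpinf x).det ≠ 0)
    (f : R2 → Vec m) (hfsm : ∀ i, ContDiff ℝ (⊤ : ℕ∞) (fun x => f x i))
    (hfsupp : ∀ x : R2, R ≤ ‖x‖ → f x = 0)
    (u : R2 → ℂ → Vec m)
    (hu : ∀ (x : R2) (t : ℂ),
      u x t = cp x t *ᵥ PiTV t (fun y => (cp y t)⁻¹ *ᵥ f y) x) :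
    ∀ ρ : ℝ, 1 < ρ → ∀ x : R2, ‖x‖ < 2*R →
      (2 * Real.pi * Complex.I : ℂ)⁻¹ • circIntV (fun t => u x t) ρ =
        cpinf x *ᵥ CauchyV (fun y => (cpinf y)⁻¹ *ᵥ f y) x := by
  intro ρ hρ x hx
  have hρ0 : 0 < ρ := by linarith
  have hnorm := norm_circPt hρ0
  have hcp : ∀ (y : R2) (φ : ℝ), ‖y‖ < 2 * R → ∀ i j,
      ContinuousAt (fun p : ℝ × R2 => cp p.2 (circPt ρ p.1) i j) (φ, y) := by
    intro y φ hy i j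
    have hnhds : {p : R2 × ℂ | ‖p.1‖ ≤ 2*R ∧ 1 ≤ ‖p.2‖} ∈ 𝓝 (y, circPt ρ φ) := by
      have hopen : IsOpen {p : R2 × ℂ | ‖p.1‖ < 2*R ∧ 1 < ‖p.2‖} :=
        (isOpen_lt continuous_fst.norm continuous_const).and
          (isOpen_lt continuous_const continuous_snd.norm)
      refine Filter.mem_of_superset (hopen.mem_nhds ⟨hy, ?_⟩) fun p hp => ⟨hp.1.le, hp.2.le⟩
      show 1 < ‖circPt ρ φ‖
      rw [hnorm]
      exact hρ
    have h1 := (hsm i j).continuousOn.continuousAt hnhds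
    exact ContinuousAt.comp (f := fun p : ℝ × R2 => (p.2, circPt ρ p.1)) (x := (φ, y)) h1
      (continuous_snd.prodMk ((continuous_circPt ρ).comp continuous_fst)).continuousAt
  set g : ℂ → R2 → Vec m := fun t y => (cp y t)⁻¹ *ᵥ f y with hg
  have hgsupp : ∀ t y, R ≤ ‖y‖ → g t y = 0 := by
    intro t y hy
    simp [hg, hfsupp y hy]
  have hgcont : ∀ j, Continuous (fun p : ℝ × R2 => g (circPt ρ p.1) p.2 j) := by
    intro j
    rw [continuous_iff_continuousAt]
    rintro ⟨φ, y⟩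
    rcases lt_or_ge ‖y‖ (2 * R) with hy | hy
    · have hM : ContinuousAt (fun p : ℝ × R2 => cp p.2 (circPt ρ p.1)) (φ, y) :=
        continuousAt_pi.2 fun i => continuousAt_pi.2 fun j => hcp y φ hy i j
      have hdety : (cp y (circPt ρ φ)).det ≠ 0 := hdet _ _ hy.le (by rw [hnorm]; exact hρ.le)
      have hinv : ContinuousAt (fun p : ℝ × R2 => (cp p.2 (circPt ρ p.1))⁻¹) (φ, y) := by
        refine ContinuousAt.comp (f := fun p : ℝ × R2 => cp p.2 (circPt ρ p.1)) (x := (φ, y))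
          (continuousAt_matrix_inv _ ?_) hM
        rw [Ring.inverse_eq_inv']
        exact continuousAt_inv₀ hdety
      simp only [hg, Matrix.mulVec, dotProduct]
      refine tendsto_finsetSum _ fun l _ => ?_
      refine ContinuousAt.mul (x := (φ, y)) ?_ ?_
      · exact continuousAt_pi.1 (continuousAt_pi.1 hinv j) l
      · exact ((hfsm l).continuous.comp continuous_snd).continuousAt
    · have hev : (fun p : ℝ × R2 => g (circPt ρ p.1) p.2 j) =ᶠ[𝓝 (φ, y)] fun _ => 0 := by
        have hopen : IsOpen {p : ℝ × R2 | R < ‖p.2‖} := isOpen_lt continuous_const continuous_snd.norm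
        filter_upwards [hopen.mem_nhds (show R < ‖y‖ by linarith)] with p hp
        rw [hgsupp _ _ (le_of_lt hp), Pi.zero_apply]
      exact continuousAt_const.congr hev.symm
  have hpcont : ∀ i j, Continuous (fun φ : ℝ => cp x (circPt ρ φ) i j) := by
    intro i j
    rw [continuous_iff_continuousAt]
    intro φ
    exact ContinuousAt.comp (f := fun φ : ℝ => (φ, x)) (x := φ) (hcp x φ hx i j)
      (by fun_prop)
  have hint : ∀ i j, Integrable (Function.uncurry fun φ y =>
      cp x (circPt ρ φ) i j * g (circPt ρ φ) y j * (Complex.I * circPt ρ φ) /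
        ker (circPt ρ φ) x y)
      ((volume.restrict (Set.uIoc 0 (2 * Real.pi))).prod volume) := by
    intro i j
    refine integrable_div_ker (R := R) hρ x (q := fun φ y =>
      cp x (circPt ρ φ) i j * g (circPt ρ φ) y j * (Complex.I * circPt ρ φ)) ?_ ?_
    · have h1 : Continuous (fun p : ℝ × R2 => cp x (circPt ρ p.1) i j) :=
        (hpcont i j).comp continuous_fst
      have h2 : Continuous (fun p : ℝ × R2 => circPt ρ p.1) :=
        (continuous_circPt ρ).comp continuous_fst
      exact (h1.mul (hgcont j)).mul (continuous_const.mul h2)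
    · intro φ y hy
      simp [hgsupp _ _ hy]
  have hres : ∀ i j, ∀ y : R2, ∫ φ in (0 : ℝ)..(2 * Real.pi),
      cp x (circPt ρ φ) i j * g (circPt ρ φ) y j * (Complex.I * circPt ρ φ) /
        ker (circPt ρ φ) x y =
      2 * Real.pi * Complex.I *
        (cpinf x i j * ((cpinf y)⁻¹ *ᵥ f y) j / (zOf x - zOf y)) := by
    intro i j y
    rcases le_or_gt R ‖y‖ with hy | hy
    · simp [hgsupp _ _ hy, hfsupp y hy]
    have hy2 : ‖y‖ ≤ 2 * R := by linarith
    have h := integral_div_ker hρ x y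
      (F := fun t => cp x t i j * g t y j)
      (H := fun s => extInf (cp x) (cpinf x) s i j *
        ((extInf (cp y) (cpinf y) s)⁻¹ *ᵥ f y) j) ?_ ?_
    · simpa only [extInf_zero] using h
    · intro s hs
      have hs1 : ‖s‖ < 1 := by simpa using hs
      refine DifferentiableAt.differentiableWithinAt ?_
      refine (differentiableAt_extInf (han x hx.le) hs1 i j).mul ?_
      simp only [Matrix.mulVec, dotProduct]
      refine DifferentiableAt.fun_sum fun l _ => ?_
      exact (DifferentiableAt.matrix_inv_apply (differentiableAt_extInf (han y hy2) hs1)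
        (det_extInf_ne_zero (hdinf y hy2) (fun t ht => hdet y t hy2 ht) hs1) j l).mul_const _
    · intro t ht
      have ht0 : t⁻¹ ≠ 0 := inv_ne_zero (norm_pos_iff.1 (by linarith))
      simp only [hg, extInf_of_ne _ _ ht0, inv_inv]
  have hterm : ∀ i j, ∀ φ : ℝ,
      cp x (circPt ρ φ) i j * PiTV (circPt ρ φ) (g (circPt ρ φ)) x j *
        (Complex.I * ρ * Complex.exp (Complex.I * φ)) =
      (Real.pi : ℂ)⁻¹ * ∫ y : R2,
        cp x (circPt ρ φ) i j * g (circPt ρ φ) y j * (Complex.I * circPt ρ φ) /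
          ker (circPt ρ φ) x y := by
    intro i j φ
    have h1 : ∀ y : R2, cp x (circPt ρ φ) i j * g (circPt ρ φ) y j * (Complex.I * circPt ρ φ) /
        ker (circPt ρ φ) x y = (cp x (circPt ρ φ) i j * (Complex.I * circPt ρ φ)) *
          (g (circPt ρ φ) y j / ker (circPt ρ φ) x y) := fun y => by ring
    simp_rw [h1]
    rw [integral_const_mul, PiTV, mul_assoc Complex.I, ← circPt]
    ring
  have hswap : ∀ i j, ∫ φ in (0 : ℝ)..(2 * Real.pi),
      cp x (circPt ρ φ) i j * PiTV (circPt ρ φ) (g (circPt ρ φ)) x j *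
        (Complex.I * ρ * Complex.exp (Complex.I * φ)) =
      2 * Real.pi * Complex.I * (cpinf x i j * CauchyV (fun y => (cpinf y)⁻¹ *ᵥ f y) x j) := by
    intro i j
    simp_rw [hterm i j]
    rw [intervalIntegral.integral_const_mul, intervalIntegral_integral_swap (hint i j)]
    simp_rw [hres i j, mul_div_assoc]
    rw [integral_const_mul, integral_const_mul, CauchyV]
    ring
  have hii : ∀ i j, IntervalIntegrable (fun φ : ℝ =>
      cp x (circPt ρ φ) i j * PiTV (circPt ρ φ) (g (circPt ρ φ)) x j *
        (Complex.I * ρ * Complex.exp (Complex.I * φ))) volume 0 (2 * Real.pi) := by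
    intro i j
    simp_rw [hterm i j]
    rw [intervalIntegrable_iff]
    exact (hint i j).integral_prod_left.const_mul _
  funext i
  have hsum : circIntV (fun t => u x t) ρ i =
      ∑ j, 2 * Real.pi * Complex.I *
        (cpinf x i j * CauchyV (fun y => (cpinf y)⁻¹ *ᵥ f y) x j) := by
    rw [← Finset.sum_congr rfl fun j _ => hswap i j,
      ← intervalIntegral.integral_finsetSum fun j _ => hii i j]
    simp only [circIntV, hu, Matrix.mulVec, dotProduct, Finset.sum_mul]
    rfl
  have hpi : (2 * Real.pi * Complex.I : ℂ) ≠ 0 := Complex.two_pi_I_ne_zero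
  rw [Pi.smul_apply, hsum, ← Finset.mul_sum, smul_eq_mul, inv_mul_cancel_left₀ hpi]
  rfl
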